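/- For every real number λ, every positive integer k and every positive integer n, the sum S_{k,λ}(n) = Σ_{j=1}^{n} (j)_{k,λ} satisfies S_{k,λ}(n) = n·(n+1)_{k,λ}/(k+1) − (1/(k+1)) · Σ_{r=1}^{k−1} (1)_{k+1−r,λ} · C(k, r−1) · S_{r,λ}(n) − (λ/(k+1)) · Σ_{r=1}^{k−1} r · C(k, r) · (1)_{k−r,λ} · S_{r,λ}(n). -/

import Mathlib

/-- The degenerate falling factorial `(x)_{n,λ} = x(x-λ)(x-2λ)⋯(x-(n-1)λ)`. -/
def dfact (lam x : ℝ) (n : ℕ) : ℝ := ∏ i ∈ Finset.range n, (x - i * lam)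

/-- The degenerate rising factorial `⟨x⟩_{n,λ} = x(x+λ)(x+2λ)⋯(x+(n-1)λ)`. -/
def drise (lam x : ℝ) (n : ℕ) : ℝ := ∏ i ∈ Finset.range n, (x + i * lam)

/-- `S_{k,λ}(n) = Σ_{j=1}^n (j)_{k,λ}`. -/
def Sdeg (lam : ℝ) (k n : ℕ) : ℝ := ∑ j ∈ Finset.Icc 1 n, dfact lam j k

theorem dfact_succ (lam x : ℝ) (n : ℕ) :
    dfact lam x (n + 1) = (x - n * lam) * dfact lam x n := by
  rw [dfact, Finset.prod_range_succ, mul_comm, dfact]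

/-- The degenerate Vandermonde convolution. -/
theorem dfact_add (lam x y : ℝ) (k : ℕ) :
    dfact lam (x + y) k = ∑ p ∈ Finset.HasAntidiagonal.antidiagonal k,
      (k.choose p.1 : ℝ) * (dfact lam x p.1 * dfact lam y p.2) := by
  induction k with
  | zero => simp [dfact]
  | succ k ih =>
    rw [Finset.sum_antidiagonal_choose_succ_mul (fun i j => dfact lam x i * dfact lam y j),
      dfact_succ, ih, Finset.mul_sum, ← Finset.sum_add_distrib]
    refine Finset.sum_congr rfl fun p hp => ?_
    obtain rfl := Finset.HasAntidiagonal.mem_antidiagonal.mp hp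
    rw [← Nat.choose_symm_add, dfact_succ, dfact_succ]
    push_cast
    ring

theorem mul_dfact_add_one (lam x : ℝ) (m : ℕ) :
    x * dfact lam (x + 1) (m + 1) = (x - 1) * dfact lam x (m + 1) +
      (m + 2) * dfact lam x (m + 1) +
      ∑ r ∈ Finset.Icc 1 m,
        dfact lam 1 (m + 2 - r) * ((m + 1).choose (r - 1) : ℝ) * dfact lam x r +
      lam * ∑ r ∈ Finset.Icc 1 m,
        (r : ℝ) * ((m + 1).choose r : ℝ) * dfact lam 1 (m + 1 - r) * dfact lam x r := by
  have split : x * dfact lam (x + 1) (m + 1) =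
      ∑ r ∈ Finset.range (m + 2),
        dfact lam 1 (m + 1 - r) * ((m + 1).choose r : ℝ) * dfact lam x (r + 1) +
      lam * ∑ r ∈ Finset.range (m + 2),
        (r : ℝ) * ((m + 1).choose r : ℝ) * dfact lam 1 (m + 1 - r) * dfact lam x r := by
    rw [dfact_add, Finset.Nat.sum_antidiagonal_eq_sum_range_succ_mk, Finset.mul_sum,
      Finset.mul_sum, ← Finset.sum_add_distrib]
    refine Finset.sum_congr rfl fun r _ => ?_
    rw [dfact_succ]
    ring
  rw [split, Finset.sum_range_succ, Finset.sum_range_succ, Finset.sum_range_succ,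
    Finset.sum_range_succ', Finset.range_eq_Ico, Finset.sum_Ico_add' (fun r : ℕ =>
      (r : ℝ) * ((m + 1).choose r : ℝ) * dfact lam 1 (m + 1 - r) * dfact lam x r)]
  have shift : ∑ r ∈ Finset.Ico 0 m,
        dfact lam 1 (m + 1 - r) * ((m + 1).choose r : ℝ) * dfact lam x (r + 1) =
      ∑ r ∈ Finset.Icc 1 m,
        dfact lam 1 (m + 2 - r) * ((m + 1).choose (r - 1) : ℝ) * dfact lam x r := by
    have h := Finset.sum_Ico_add' (fun r : ℕ =>
      dfact lam 1 (m + 2 - r) * ((m + 1).choose (r - 1) : ℝ) * dfact lam x r) 0 m 1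
    rw [zero_add, Finset.Ico_add_one_right_eq_Icc] at h
    rw [← h]
    refine Finset.sum_congr rfl fun r _ => ?_
    rw [Nat.add_sub_cancel, Nat.add_sub_add_right m.succ 1 r]
  have one : dfact lam 1 1 = 1 := by simp [dfact]
  have zero : dfact lam 1 0 = 1 := by simp [dfact]
  rw [shift, zero_add, Finset.Ico_add_one_right_eq_Icc, Nat.sub_self, Nat.add_sub_cancel_left,
    one, zero, Nat.choose_self, Nat.choose_succ_self_right, dfact_succ lam x (m + 1)]
  push_cast
  ring

theorem mul_dfact_add_one_eq_sum (lam : ℝ) (k n : ℕ) :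
    n * dfact lam (n + 1) k = ∑ j ∈ Finset.Icc 1 n,
      ((j : ℝ) * dfact lam (j + 1) k - (j - 1) * dfact lam j k) := by
  induction n with
  | zero => simp
  | succ n ih =>
    rw [Finset.sum_Icc_succ_top (by omega), ← ih]
    push_cast
    ring

theorem stmt_3 (lam : ℝ) (k n : ℕ) (hk : 0 < k) (hn : 0 < n) :
    Sdeg lam k n =
      n * dfact lam (n + 1) k / (k + 1) -
        (1 / (k + 1)) * ∑ r ∈ Finset.Icc 1 (k - 1),
          dfact lam 1 (k + 1 - r) * (k.choose (r - 1) : ℝ) * Sdeg lam r n -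
        (lam / (k + 1)) * ∑ r ∈ Finset.Icc 1 (k - 1),
          (r : ℝ) * (k.choose r : ℝ) * dfact lam 1 (k - r) * Sdeg lam r n := by
  obtain ⟨m, rfl⟩ := Nat.exists_eq_add_one.mpr hk
  have key : n * dfact lam (n + 1) (m + 1) = (m + 2) * Sdeg lam (m + 1) n +
      ∑ r ∈ Finset.Icc 1 m,
        dfact lam 1 (m + 2 - r) * ((m + 1).choose (r - 1) : ℝ) * Sdeg lam r n +
      lam * ∑ r ∈ Finset.Icc 1 m,
        (r : ℝ) * ((m + 1).choose r : ℝ) * dfact lam 1 (m + 1 - r) * Sdeg lam r n := by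
    simp only [Sdeg, Finset.mul_sum]
    rw [Finset.sum_comm, Finset.sum_comm (s := Finset.Icc 1 m) (t := Finset.Icc 1 n),
      ← Finset.sum_add_distrib, ← Finset.sum_add_distrib, mul_dfact_add_one_eq_sum]
    refine Finset.sum_congr rfl fun j _ => ?_
    rw [mul_dfact_add_one, Finset.mul_sum]
    ring
  have hm : (m : ℝ) + 1 + 1 ≠ 0 := by positivity
  rw [key, Nat.add_sub_cancel]
  push_cast
  field_simp
  ring
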